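/- arXiv:2312.09342 — 4 statements merged into one kernel-verified Lean document; each statement's English description precedes it below -/
import Mathlib

section
/- Assume conditions (I)–(IV) of the abstract symbolic scheme. Then for every f ∈ Ẽ^0 there exists a unique u ∈ E^0 with L u = f; that is, L : E^0 → Ẽ^0 is bijective. -/
/-- Under conditions (I)–(IV) of the abstract symbolic scheme,
`L : E⁰ → Ẽ⁰` is bijective: every `f ∈ Ẽ⁰` has a unique preimage `u ∈ E⁰`.
Here `E 0 = ⊤` and `Ẽ 0 = ⊤`, so `E⁰ = V` and `Ẽ⁰ = W`. -/
theorem stmt0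
    {K : Type*} [Field K]
    {V W : Type*} [AddCommGroup V] [Module K V] [AddCommGroup W] [Module K W]
    (E : ℕ → Submodule K V) (E' : ℕ → Submodule K W)
    (hE0 : E 0 = ⊤) (hE'0 : E' 0 = ⊤)
    (hE : Antitone E) (hE' : Antitone E')
    (L : V →ₗ[K] W)
    (hL : ∀ j, ∀ u ∈ E j, L u ∈ E' j)
    (F F' : ℕ → Type*)
    [∀ j, AddCommGroup (F j)] [∀ j, Module K (F j)]
    [∀ j, AddCommGroup (F' j)] [∀ j, Module K (F' j)]
    (σ : ∀ j, (E j) →ₗ[K] F j) (σ' : ∀ j, (E' j) →ₗ[K] F' j)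
    (T : ∀ j, F j →ₗ[K] F' j)
    -- compatibility: σ̃ʲ(L u) = Tʲ(σʲ u)
    (compat : ∀ j (u : E j), σ' j ⟨L u, hL j u u.2⟩ = T j (σ j u))
    -- (I) principal symbol maps: exact rows
    (hσ_surj : ∀ j, Function.Surjective (σ j))
    (hσ_ker : ∀ j (u : E j), σ j u = 0 ↔ (u : V) ∈ E (j + 1))
    (hσ'_surj : ∀ j, Function.Surjective (σ' j))
    (hσ'_ker : ∀ j (f : E' j), σ' j f = 0 ↔ (f : W) ∈ E' (j + 1))
    -- (II) transport equations: Tʲ bijective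
    (hT : ∀ j, Function.Bijective (T j))
    -- (III) asymptotic completeness
    (hAC : ∀ u : ℕ → V, (∀ j, u j ∈ E j) →
      ∃ v : V, ∀ J : ℕ, v - ∑ j ∈ Finset.range J, u j ∈ E J)
    -- (IV) well-posedness: L : E^∞ → Ẽ^∞ bijective
    (hWP : ∀ f ∈ (⨅ j, E' j), ∃! u : V, u ∈ (⨅ j, E j) ∧ L u = f) :
    ∀ f : W, ∃! u : V, L u = f := by
  have lift : ∀ j (f : W), ∃ u ∈ E j, f ∈ E' j → f - L u ∈ E' (j + 1) := by
    intro j f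
    by_cases hf : f ∈ E' j
    · obtain ⟨a, ha⟩ := (hT j).2 (σ' j ⟨f, hf⟩)
      obtain ⟨u, rfl⟩ := hσ_surj j a
      refine ⟨u, u.2, fun _ => ?_⟩
      refine (hσ'_ker j (⟨f, hf⟩ - ⟨L u, hL j u u.2⟩)).1 ?_
      rw [map_sub, compat, ha, sub_self]
    · exact ⟨0, zero_mem _, fun h => absurd h hf⟩
  have kernel_mem : ∀ u, L u = 0 → ∀ j, u ∈ E j := by
    intro u hu j
    induction j with
    | zero => simp [hE0]
    | succ j ih =>
      refine (hσ_ker j ⟨u, ih⟩).1 ((hT j).1 ?_)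
      rw [← compat, map_zero]
      exact (hσ'_ker j _).2 (by simp [hu])
  have injective : ∀ u, L u = 0 → u = 0 := fun u hu =>
    (hWP 0 (zero_mem _)).unique ⟨(Submodule.mem_iInf _).2 (kernel_mem u hu), hu⟩
      ⟨zero_mem _, map_zero L⟩
  intro f
  choose g hg hgL using lift
  let r : ℕ → W := fun n => Nat.rec f (fun j w => w - L (g j w)) n
  have hr_succ : ∀ j, r (j + 1) = r j - L (g j (r j)) := fun _ => rfl
  have hr_mem : ∀ j, r j ∈ E' j := by
    intro j
    induction j with
    | zero => simp [hE'0]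
    | succ j ih => exact hgL j (r j) ih
  have hr_sum : ∀ J, r J = f - L (∑ j ∈ Finset.range J, g j (r j)) := by
    intro J
    induction J with
    | zero => simp [r]
    | succ J ih => rw [hr_succ, Finset.sum_range_succ, map_add, ← sub_sub, ← ih]
  obtain ⟨v, hv⟩ := hAC (fun j => g j (r j)) fun j => hg j (r j)
  have hres : f - L v ∈ ⨅ j, E' j := by
    refine (Submodule.mem_iInf _).2 fun J => ?_
    have h := sub_mem (hr_mem J) (hL J _ (hv J))
    rwa [hr_sum, map_sub, sub_sub, add_sub_cancel] at h
  obtain ⟨w, ⟨-, hw⟩, -⟩ := hWP _ hres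
  refine ⟨v + w, by simp [hw], fun u hu => sub_eq_zero.1 (injective _ ?_)⟩
  rw [map_sub, map_add, hu, hw, add_sub_cancel, sub_self]
end

section
/- Assume conditions (I), (II) and (III) of the abstract symbolic scheme (but not necessarily (IV)). Then for every f ∈ Ẽ^0 there exists u ∈ E^0 with L u − f ∈ Ẽ^∞; moreover this u is unique modulo E^∞, i.e. any two such solutions differ by an element of E^∞. -/
/-- If every element of `E' j` agrees modulo `E' (j + 1)` with the image of an element of `E j`,
and formal series in `E` can be summed asymptotically, then `L u = f` is solvable modulo
`⨅ j, E' j`. -/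
theorem exists_map_sub_mem_iInf_of_step {R V W : Type*} [Ring R]
    [AddCommGroup V] [Module R V] [AddCommGroup W] [Module R W]
    {E : ℕ → Submodule R V} {E' : ℕ → Submodule R W} (L : V →ₗ[R] W)
    (hL : ∀ j, ∀ u ∈ E j, L u ∈ E' j)
    (step : ∀ j, ∀ g ∈ E' j, ∃ w ∈ E j, g - L w ∈ E' (j + 1))
    (hAC : ∀ u : ℕ → V, (∀ j, u j ∈ E j) →
      ∃ v : V, ∀ J : ℕ, v - ∑ j ∈ Finset.range J, u j ∈ E J)
    {f : W} (hf : f ∈ E' 0) :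
    ∃ u : V, L u - f ∈ ⨅ j, E' j := by
  choose! w hw hw' using step
  let g : ℕ → W := fun n => Nat.rec f (fun j x => x - L (w j x)) n
  have hg : ∀ j, g j ∈ E' j := by
    intro j
    induction j with
    | zero => exact hf
    | succ j ih => exact hw' j _ ih
  have hsum : ∀ J, L (∑ j ∈ Finset.range J, w j (g j)) = f - g J := by
    intro J
    induction J with
    | zero => simp [g]
    | succ J ih =>
      have hsucc : g (J + 1) = g J - L (w J (g J)) := rfl
      rw [Finset.sum_range_succ, map_add, ih, hsucc]
      abel
  obtain ⟨v, hv⟩ := hAC (fun j => w j (g j)) fun j => hw j _ (hg j)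
  refine ⟨v, (Submodule.mem_iInf _).2 fun J => ?_⟩
  have h := (E' J).sub_mem (hL J _ (hv J)) (hg J)
  rw [map_sub, hsum] at h
  convert h using 1
  abel

/-- Under conditions (I), (II) and (III) of the abstract symbolic
scheme (but not necessarily (IV)): for every `f ∈ Ẽ⁰` there is `u ∈ E⁰` with
`L u - f ∈ Ẽ^∞`, and this `u` is unique modulo `E^∞`. -/
theorem stmt3
    {K : Type*} [Field K]
    {V W : Type*} [AddCommGroup V] [Module K V] [AddCommGroup W] [Module K W]
    (E : ℕ → Submodule K V) (E' : ℕ → Submodule K W)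
    (hE0 : E 0 = ⊤) (hE'0 : E' 0 = ⊤)
    (hE : Antitone E) (hE' : Antitone E')
    (L : V →ₗ[K] W)
    (hL : ∀ j, ∀ u ∈ E j, L u ∈ E' j)
    (F F' : ℕ → Type*)
    [∀ j, AddCommGroup (F j)] [∀ j, Module K (F j)]
    [∀ j, AddCommGroup (F' j)] [∀ j, Module K (F' j)]
    (σ : ∀ j, (E j) →ₗ[K] F j) (σ' : ∀ j, (E' j) →ₗ[K] F' j)
    (T : ∀ j, F j →ₗ[K] F' j)
    (compat : ∀ j (u : E j), σ' j ⟨L u, hL j u u.2⟩ = T j (σ j u))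
    -- (I)
    (hσ_surj : ∀ j, Function.Surjective (σ j))
    (hσ_ker : ∀ j (u : E j), σ j u = 0 ↔ (u : V) ∈ E (j + 1))
    (hσ'_surj : ∀ j, Function.Surjective (σ' j))
    (hσ'_ker : ∀ j (f : E' j), σ' j f = 0 ↔ (f : W) ∈ E' (j + 1))
    -- (II)
    (hT : ∀ j, Function.Bijective (T j))
    -- (III)
    (hAC : ∀ u : ℕ → V, (∀ j, u j ∈ E j) →
      ∃ v : V, ∀ J : ℕ, v - ∑ j ∈ Finset.range J, u j ∈ E J) :
    ∀ f : W,
      (∃ u : V, L u - f ∈ (⨅ j, E' j)) ∧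
      (∀ u v : V, L u - f ∈ (⨅ j, E' j) → L v - f ∈ (⨅ j, E' j) →
        u - v ∈ (⨅ j, E j)) := by
  have step : ∀ j, ∀ g ∈ E' j, ∃ w ∈ E j, g - L w ∈ E' (j + 1) := by
    intro j g hg
    obtain ⟨a, ha⟩ := (hT j).surjective (σ' j ⟨g, hg⟩)
    obtain ⟨w, rfl⟩ := hσ_surj j a
    refine ⟨w, w.2, (hσ'_ker j (⟨g, hg⟩ - ⟨L w, hL j w w.2⟩)).1 ?_⟩
    rw [map_sub, compat, ha, sub_self]
  have reflect : ∀ w : V, L w ∈ (⨅ j, E' j) → ∀ j, w ∈ E j := by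
    intro w hw j
    induction j with
    | zero => simp [hE0]
    | succ j ih =>
      refine (hσ_ker j ⟨w, ih⟩).1 ((hT j).injective ?_)
      rw [← compat, map_zero]
      exact (hσ'_ker j _).2 ((Submodule.mem_iInf _).1 hw (j + 1))
  refine fun f => ⟨exists_map_sub_mem_iInf_of_step L hL step hAC (by simp [hE'0]),
    fun u v hu hv => (Submodule.mem_iInf _).2 (reflect _ ?_)⟩
  simpa using Submodule.sub_mem _ hu hv
end

section
/- Assume conditions (I)–(IV) of the abstract symbolic scheme. Then for every j ∈ ℕ the restriction of L to a map E^j → Ẽ^j is bijective: for every f ∈ Ẽ^j there exists a unique u ∈ E^j with L u = f. -/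
/-- Under conditions (I)–(IV) of the abstract symbolic scheme:
for every `j ∈ ℕ` the restriction of `L` to a map `E^j → Ẽ^j` is bijective, i.e.
for every `f ∈ Ẽ^j` there is a unique `u ∈ E^j` with `L u = f`. -/
theorem stmt4
    {K : Type*} [Field K]
    {V W : Type*} [AddCommGroup V] [Module K V] [AddCommGroup W] [Module K W]
    (E : ℕ → Submodule K V) (E' : ℕ → Submodule K W)
    (hE0 : E 0 = ⊤) (hE'0 : E' 0 = ⊤)
    (hE : Antitone E) (hE' : Antitone E')
    (L : V →ₗ[K] W)
    (hL : ∀ j, ∀ u ∈ E j, L u ∈ E' j)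
    (F F' : ℕ → Type*)
    [∀ j, AddCommGroup (F j)] [∀ j, Module K (F j)]
    [∀ j, AddCommGroup (F' j)] [∀ j, Module K (F' j)]
    (σ : ∀ j, (E j) →ₗ[K] F j) (σ' : ∀ j, (E' j) →ₗ[K] F' j)
    (T : ∀ j, F j →ₗ[K] F' j)
    (compat : ∀ j (u : E j), σ' j ⟨L u, hL j u u.2⟩ = T j (σ j u))
    -- (I)
    (hσ_surj : ∀ j, Function.Surjective (σ j))
    (hσ_ker : ∀ j (u : E j), σ j u = 0 ↔ (u : V) ∈ E (j + 1))
    (hσ'_surj : ∀ j, Function.Surjective (σ' j))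
    (hσ'_ker : ∀ j (f : E' j), σ' j f = 0 ↔ (f : W) ∈ E' (j + 1))
    -- (II)
    (hT : ∀ j, Function.Bijective (T j))
    -- (III)
    (hAC : ∀ u : ℕ → V, (∀ j, u j ∈ E j) →
      ∃ v : V, ∀ J : ℕ, v - ∑ j ∈ Finset.range J, u j ∈ E J)
    -- (IV)
    (hWP : ∀ f ∈ (⨅ j, E' j), ∃! u : V, u ∈ (⨅ j, E j) ∧ L u = f) :
    ∀ j : ℕ, ∀ f ∈ E' j, ∃! u : V, u ∈ E j ∧ L u = f := by
  have lift : ∀ j (f : W), ∃ u ∈ E j, f ∈ E' j → f - L u ∈ E' (j + 1) := by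
    intro j f
    by_cases hf : f ∈ E' j
    · obtain ⟨a, ha⟩ := (hT j).2 (σ' j ⟨f, hf⟩)
      obtain ⟨u, rfl⟩ := hσ_surj j a
      refine ⟨u, u.2, fun _ => ?_⟩
      refine (hσ'_ker j (⟨f, hf⟩ - ⟨L u, hL j u u.2⟩)).1 ?_
      rw [map_sub, compat, ha, sub_self]
    · exact ⟨0, zero_mem _, fun h => absurd h hf⟩
  have regularity : ∀ j (u : V), L u ∈ E' j → u ∈ E j := by
    intro j
    induction j with
    | zero => intro u _; simp [hE0]
    | succ j ih =>
      intro u hu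
      have huj : u ∈ E j := ih u (hE' j.le_succ hu)
      refine (hσ_ker j ⟨u, huj⟩).1 ((hT j).1 ?_)
      rw [← compat, map_zero]
      exact (hσ'_ker j _).2 hu
  choose S hSmem hS using lift
  have surj : ∀ f : W, ∃ u : V, L u = f := by
    intro f
    let r : ℕ → W := fun n => Nat.rec f (fun j g => g - L (S j g)) n
    have hr_succ : ∀ j, r (j + 1) = r j - L (S j (r j)) := fun _ => rfl
    have hr : ∀ j, r j ∈ E' j := by
      intro j
      induction j with
      | zero => simp [hE'0]
      | succ j ih => exact hS j (r j) ih
    have hsum : ∀ J, f - L (∑ j ∈ Finset.range J, S j (r j)) = r J := by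
      intro J
      induction J with
      | zero => simp [r]
      | succ J ih => rw [Finset.sum_range_succ, map_add, ← sub_sub, ih, hr_succ]
    obtain ⟨v, hv⟩ := hAC (fun j => S j (r j)) fun j => hSmem j (r j)
    have hres : f - L v ∈ ⨅ j, E' j := by
      refine (Submodule.mem_iInf _).2 fun J => ?_
      have h := sub_mem (hr J) (hL J _ (hv J))
      rwa [← hsum J, map_sub, sub_sub, add_sub_cancel] at h
    obtain ⟨w, ⟨_, hw⟩, _⟩ := hWP _ hres
    exact ⟨v + w, by rw [map_add, hw, add_sub_cancel]⟩
  intro j f hf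
  obtain ⟨u, rfl⟩ := surj f
  refine ⟨u, ⟨regularity j u hf, rfl⟩, fun v hv => ?_⟩
  have hker : L (v - u) = 0 := by rw [map_sub, hv.2, sub_self]
  have hmem : v - u ∈ ⨅ j, E j :=
    (Submodule.mem_iInf _).2 fun J => regularity J _ (hker ▸ zero_mem _)
  exact sub_eq_zero.1 <|
    (hWP 0 (zero_mem _)).unique ⟨hmem, hker⟩ ⟨zero_mem _, map_zero L⟩
end

section
/- Assume conditions (I)–(IV) of the abstract symbolic scheme. Then Ẽ^0 is asymptotically complete for the filtration (Ẽ^j): for every sequence (f_j)_{j∈ℕ} with f_j ∈ Ẽ^j for all j there exists f ∈ Ẽ^0 such that f − Σ_{j<J} f_j ∈ Ẽ^J for every J ∈ ℕ. -/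
/-- If a filtered linear map is onto modulo the next filtration step, then asymptotic
completeness passes from its source to its target. -/
theorem LinearMap.asymptoticallyComplete_of_forall_exists_sub_mem
    {K V W : Type*} [Ring K] [AddCommGroup V] [Module K V] [AddCommGroup W] [Module K W]
    (E : ℕ → Submodule K V) (E' : ℕ → Submodule K W) (L : V →ₗ[K] W)
    (hL : ∀ j, ∀ u ∈ E j, L u ∈ E' j)
    (hstep : ∀ j, ∀ w : E' j, ∃ u : E j, (w : W) - L u ∈ E' (j + 1))
    (hAC : ∀ u : ℕ → V, (∀ j, u j ∈ E j) →
      ∃ v : V, ∀ J : ℕ, v - ∑ j ∈ Finset.range J, u j ∈ E J)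
    (f : ℕ → W) (hf : ∀ j, f j ∈ E' j) :
    ∃ g : W, ∀ J : ℕ, g - ∑ j ∈ Finset.range J, f j ∈ E' J := by
  choose a ha using hstep
  let r : ∀ j, E' j := fun j => Nat.rec (motive := fun j => E' j) 0
    (fun j w => ⟨w + f j - L (a j (w + ⟨f j, hf j⟩)), ha j (w + ⟨f j, hf j⟩)⟩) j
  let u : ℕ → V := fun j => a j (r j + ⟨f j, hf j⟩)
  have hr (j : ℕ) : (r (j + 1)).1 = (r j).1 + f j - L (u j) := rfl
  have hsum : ∀ J, (r J).1 = ∑ j ∈ Finset.range J, f j - L (∑ j ∈ Finset.range J, u j) := by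
    intro J
    induction J with
    | zero => simp [r]
    | succ J ih =>
      rw [hr, ih, Finset.sum_range_succ, Finset.sum_range_succ, map_add]
      abel
  obtain ⟨v, hv⟩ := hAC u fun j => (a j _).2
  refine ⟨L v, fun J => ?_⟩
  have h := (E' J).sub_mem (hL J _ (hv J)) (r J).2
  rw [hsum, map_sub] at h
  convert h using 1
  abel

/-- Under conditions (I)–(IV) of the abstract symbolic scheme:
`Ẽ⁰` is asymptotically complete for the filtration `(Ẽ^j)`: for every sequence
`(f_j)` with `f_j ∈ Ẽ^j` there is `f ∈ Ẽ⁰` with `f - Σ_{j<J} f_j ∈ Ẽ^J` for all `J`. -/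
theorem stmt5
    {K : Type*} [Field K]
    {V W : Type*} [AddCommGroup V] [Module K V] [AddCommGroup W] [Module K W]
    (E : ℕ → Submodule K V) (E' : ℕ → Submodule K W)
    (hE0 : E 0 = ⊤) (hE'0 : E' 0 = ⊤)
    (hE : Antitone E) (hE' : Antitone E')
    (L : V →ₗ[K] W)
    (hL : ∀ j, ∀ u ∈ E j, L u ∈ E' j)
    (F F' : ℕ → Type*)
    [∀ j, AddCommGroup (F j)] [∀ j, Module K (F j)]
    [∀ j, AddCommGroup (F' j)] [∀ j, Module K (F' j)]
    (σ : ∀ j, (E j) →ₗ[K] F j) (σ' : ∀ j, (E' j) →ₗ[K] F' j)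
    (T : ∀ j, F j →ₗ[K] F' j)
    (compat : ∀ j (u : E j), σ' j ⟨L u, hL j u u.2⟩ = T j (σ j u))
    -- (I)
    (hσ_surj : ∀ j, Function.Surjective (σ j))
    (hσ_ker : ∀ j (u : E j), σ j u = 0 ↔ (u : V) ∈ E (j + 1))
    (hσ'_surj : ∀ j, Function.Surjective (σ' j))
    (hσ'_ker : ∀ j (f : E' j), σ' j f = 0 ↔ (f : W) ∈ E' (j + 1))
    -- (II)
    (hT : ∀ j, Function.Bijective (T j))
    -- (III)
    (hAC : ∀ u : ℕ → V, (∀ j, u j ∈ E j) →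
      ∃ v : V, ∀ J : ℕ, v - ∑ j ∈ Finset.range J, u j ∈ E J)
    -- (IV)
    (hWP : ∀ f ∈ (⨅ j, E' j), ∃! u : V, u ∈ (⨅ j, E j) ∧ L u = f) :
    ∀ f : ℕ → W, (∀ j, f j ∈ E' j) →
      ∃ g : W, ∀ J : ℕ, g - ∑ j ∈ Finset.range J, f j ∈ E' J := by
  refine L.asymptoticallyComplete_of_forall_exists_sub_mem E E' hL (fun j w => ?_) hAC
  obtain ⟨y, hy⟩ := (hT j).2 (σ' j w)
  obtain ⟨u, rfl⟩ := hσ_surj j y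
  refine ⟨u, (hσ'_ker j (w - ⟨L u, hL j u u.2⟩)).1 ?_⟩
  rw [map_sub, compat, hy, sub_self]
end
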